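/- Let 𝒴 and 𝒳 be finite sets and μ_{YX} a fixed joint law of (Y,X). For some n ∈ ℕ, let f : 𝒳^n → M be a function with M a finite set. Then there exists a probability measure μ_{YXU}, extending μ_{YX}, with 𝒰 finite, such that the Markov chain Y ⊸ X ⊸ U holds, I(X;U) ≤ (1/n)·log|M|, and I(Y;U) ≥ (1/n)·I(Y^n; f(X^n)), where (Y^n,X^n) are n i.i.d. copies of (Y,X). -/

import Mathlib

open MeasureTheory Real
open scoped ENNReal

noncomputable section

namespace IB

/-- Real-valued indicator function of a set. -/
def ind {Ω : Type*} (s : Set Ω) : Ω → ℝ := Set.indicator s (fun _ => (1 : ℝ))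

/-- Shannon entropy of a random variable with finite alphabet. -/
noncomputable def ent {Ω α : Type*} [MeasurableSpace Ω] [Fintype α]
    (μ : Measure Ω) (A : Ω → α) : ℝ :=
  ∑ a : α, Real.negMulLog ((μ (A ⁻¹' {a})).toReal)

/-- Discrete mutual information `I(A;B) = H(A) + H(B) - H(A,B)` for finite alphabets. -/
noncomputable def miFin {Ω α β : Type*} [MeasurableSpace Ω] [Fintype α] [Fintype β]
    (μ : Measure Ω) (A : Ω → α) (B : Ω → β) : ℝ :=
  ent μ A + ent μ B - ent μ (fun ω => (A ω, B ω))

/-- Mutual information of random variables with arbitrary alphabets: the supremum of the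
discrete mutual information over all measurable finite-range quantizations. -/
noncomputable def miGen {Ω α β : Type*} [MeasurableSpace Ω] [MeasurableSpace α]
    [MeasurableSpace β] (μ : Measure Ω) (A : Ω → α) (B : Ω → β) : ℝ≥0∞ :=
  ⨆ (k : ℕ) (l : ℕ) (f : α → Fin (k + 1)) (g : β → Fin (l + 1))
    (_ : Measurable f) (_ : Measurable g),
      ENNReal.ofReal (miFin μ (f ∘ A) (g ∘ B))

/-- The Markov chain `A ⊸ B ⊸ C`: conditional independence of `A` and `C` given `σ(B)`,
expressed via conditional expectations of indicator functions. -/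
def Markov {Ω α β γ : Type*} [MeasurableSpace Ω] [MeasurableSpace α] [MeasurableSpace β]
    [MeasurableSpace γ] (μ : Measure Ω) (A : Ω → α) (B : Ω → β) (C : Ω → γ) : Prop :=
  ∀ E F, MeasurableSet E → MeasurableSet F →
    μ[ind (A ⁻¹' E ∩ C ⁻¹' F) | MeasurableSpace.comap B inferInstance]
      =ᵐ[μ]
    fun ω => (μ[ind (A ⁻¹' E) | MeasurableSpace.comap B inferInstance]) ω *
             (μ[ind (C ⁻¹' F) | MeasurableSpace.comap B inferInstance]) ω

/-! ### Shannon entropy on a finite probability space -/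

section Entropy

theorem ent_map {Ω Ω₂ α : Type*} [Finite Ω] [MeasurableSpace Ω] [MeasurableSingletonClass Ω]
    [Fintype α] (μ : Measure Ω) [MeasurableSpace Ω₂] [MeasurableSingletonClass Ω₂] [Finite Ω₂]
    (φ : Ω → Ω₂) (A : Ω₂ → α) : ent (μ.map φ) A = ent μ fun ω => A (φ ω) := by
  refine Finset.sum_congr rfl fun a _ => ?_
  rw [Measure.map_apply (measurable_of_finite φ) MeasurableSet.of_discrete]
  rfl

theorem real_preimage_pos {Ω α : Type*} [MeasurableSpace Ω] (μ : Measure Ω)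
    [IsProbabilityMeasure μ] {A : Ω → α} {ω : Ω} (hω : 0 < μ.real {ω}) :
    0 < μ.real (A ⁻¹' {A ω}) :=
  hω.trans_le (measureReal_mono (by simp))

variable {Ω α β γ : Type*} [Fintype Ω] [MeasurableSpace Ω] [MeasurableSingletonClass Ω]
  [Fintype α] [Fintype β] [Fintype γ] (μ : Measure Ω) [IsProbabilityMeasure μ]

theorem sum_real_singleton_eq_one : ∑ ω, μ.real {ω} = 1 := by
  rw [sum_measureReal_singleton]
  simp

theorem sum_real_preimage_singleton_eq_one (A : Ω → α) : ∑ a, μ.real (A ⁻¹' {a}) = 1 := by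
  rw [sum_measureReal_preimage_singleton _ fun _ _ => MeasurableSet.of_discrete]
  simp

theorem sum_real_mul_comp (A : Ω → α) (F : α → ℝ) :
    ∑ ω, μ.real {ω} * F (A ω) = ∑ a, μ.real (A ⁻¹' {a}) * F a := by
  classical
  rw [← Finset.sum_fiberwise Finset.univ A]
  refine Finset.sum_congr rfl fun a _ => ?_
  have h : A ⁻¹' {a} = ((Finset.univ.filter fun ω => A ω = a : Finset Ω) : Set Ω) := by
    ext; simp
  rw [h, ← sum_measureReal_singleton, Finset.sum_mul]
  exact Finset.sum_congr rfl fun ω hω => by rw [(Finset.mem_filter.1 hω).2]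

theorem ent_eq_sum (A : Ω → α) :
    ent μ A = -∑ ω, μ.real {ω} * log (μ.real (A ⁻¹' {A ω})) := by
  rw [sum_real_mul_comp μ A fun a => log (μ.real (A ⁻¹' {a})), ent, ← Finset.sum_neg_distrib]
  exact Finset.sum_congr rfl fun a _ => by simp [negMulLog, Measure.real]

/-- Entropy only depends on the partition of the sample space induced by the random variable. -/
theorem ent_congr {A : Ω → α} {B : Ω → β} (h : ∀ ω ω', A ω = A ω' ↔ B ω = B ω') :
    ent μ A = ent μ B := by
  rw [ent_eq_sum, ent_eq_sum]
  congr 1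
  refine Finset.sum_congr rfl fun ω _ => ?_
  have : A ⁻¹' {A ω} = B ⁻¹' {B ω} := by
    ext ω'
    simpa using h ω' ω
  rw [this]

theorem sum_real_preimage_pair_left (A : Ω → α) (B : Ω → β) (b : β) :
    ∑ a, μ.real ((fun ω => (A ω, B ω)) ⁻¹' {(a, b)}) = μ.real (B ⁻¹' {b}) := by
  classical
  have h := sum_real_mul_comp μ (fun ω => (A ω, B ω)) fun p => if p.2 = b then 1 else 0
  have hmarg := sum_real_mul_comp μ B fun p => if p = b then 1 else 0
  rw [Fintype.sum_prod_type] at h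
  simpa using h.symm.trans hmarg

theorem sum_real_preimage_pair_right (A : Ω → α) (B : Ω → β) (a : α) :
    ∑ b, μ.real ((fun ω => (A ω, B ω)) ⁻¹' {(a, b)}) = μ.real (A ⁻¹' {a}) := by
  classical
  have h := sum_real_mul_comp μ (fun ω => (A ω, B ω)) fun p => if p.1 = a then 1 else 0
  have hmarg := sum_real_mul_comp μ A fun p => if p = a then 1 else 0
  rw [Fintype.sum_prod_type_right] at h
  simpa using h.symm.trans hmarg

/-- Strong subadditivity of Shannon entropy. -/
theorem ent_submodular (A : Ω → α) (B : Ω → β) (C : Ω → γ) :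
    ent μ (fun ω => (A ω, B ω, C ω)) + ent μ B ≤
      ent μ (fun ω => (A ω, B ω)) + ent μ (fun ω => (B ω, C ω)) := by
  set ABC : Ω → α × β × γ := fun ω => (A ω, B ω, C ω)
  set AB : Ω → α × β := fun ω => (A ω, B ω)
  set BC : Ω → β × γ := fun ω => (B ω, C ω)
  set r : α × β × γ → ℝ := fun x =>
    μ.real (AB ⁻¹' {(x.1, x.2.1)}) * μ.real (BC ⁻¹' {x.2}) /
      (μ.real (ABC ⁻¹' {x}) * μ.real (B ⁻¹' {x.2.1})) with hr
  have h1 : ∑ ω, μ.real {ω} * r (ABC ω) ≤ 1 := by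
    rw [sum_real_mul_comp μ ABC r]
    have hle : ∀ x, μ.real (ABC ⁻¹' {x}) * r x ≤
        μ.real (AB ⁻¹' {(x.1, x.2.1)}) * μ.real (BC ⁻¹' {x.2}) / μ.real (B ⁻¹' {x.2.1}) := by
      intro x
      rcases eq_or_ne (μ.real (ABC ⁻¹' {x})) 0 with h | h
      · rw [h, zero_mul]
        positivity
      · rw [hr]
        simp only
        rw [mul_div_assoc', mul_div_mul_left _ _ h]
    refine (Finset.sum_le_sum fun x _ => hle x).trans (le_of_eq ?_)
    rw [Fintype.sum_prod_type_right, Fintype.sum_prod_type]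
    rw [← sum_real_preimage_singleton_eq_one μ B]
    refine Finset.sum_congr rfl fun b _ => ?_
    calc ∑ c, ∑ a, μ.real (AB ⁻¹' {(a, b)}) * μ.real (BC ⁻¹' {(b, c)}) / μ.real (B ⁻¹' {b})
        = (∑ a, μ.real (AB ⁻¹' {(a, b)})) * (∑ c, μ.real (BC ⁻¹' {(b, c)})) /
            μ.real (B ⁻¹' {b}) := by
          rw [Finset.sum_mul_sum, Finset.sum_comm, Finset.sum_div]
          exact Finset.sum_congr rfl fun a _ => by rw [Finset.sum_div]
      _ = μ.real (B ⁻¹' {b}) := by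
          rw [sum_real_preimage_pair_left, sum_real_preimage_pair_right, mul_self_div_self]
  have h2 : ∀ ω, μ.real {ω} * (log (μ.real (AB ⁻¹' {AB ω})) + log (μ.real (BC ⁻¹' {BC ω}))
      - log (μ.real (ABC ⁻¹' {ABC ω})) - log (μ.real (B ⁻¹' {B ω})))
      ≤ μ.real {ω} * r (ABC ω) - μ.real {ω} := by
    intro ω
    rcases (measureReal_nonneg (μ := μ) (s := {ω})).eq_or_lt with h | h
    · simp [← h]
    have p1 := real_preimage_pos μ (A := AB) h
    have p2 := real_preimage_pos μ (A := BC) h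
    have p3 := real_preimage_pos μ (A := ABC) h
    have p4 := real_preimage_pos μ (A := B) h
    have hlog : log (r (ABC ω)) = log (μ.real (AB ⁻¹' {AB ω})) + log (μ.real (BC ⁻¹' {BC ω}))
      - log (μ.real (ABC ⁻¹' {ABC ω})) - log (μ.real (B ⁻¹' {B ω})) := by
      have : r (ABC ω) = μ.real (AB ⁻¹' {AB ω}) * μ.real (BC ⁻¹' {BC ω}) /
        (μ.real (ABC ⁻¹' {ABC ω}) * μ.real (B ⁻¹' {B ω})) := rfl
      rw [this, log_div (by positivity) (by positivity), log_mul p1.ne' p2.ne',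
        log_mul p3.ne' p4.ne']
      ring
    have hpos : 0 < r (ABC ω) := by
      change 0 < μ.real (AB ⁻¹' {AB ω}) * μ.real (BC ⁻¹' {BC ω}) /
        (μ.real (ABC ⁻¹' {ABC ω}) * μ.real (B ⁻¹' {B ω}))
      positivity
    rw [← hlog]
    nlinarith [log_le_sub_one_of_pos hpos]
  have h3 := Finset.sum_le_sum fun ω (_ : ω ∈ Finset.univ) => h2 ω
  rw [Finset.sum_sub_distrib, sum_real_singleton_eq_one] at h3
  simp only [mul_sub, mul_add, Finset.sum_sub_distrib, Finset.sum_add_distrib] at h3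
  rw [ent_eq_sum, ent_eq_sum, ent_eq_sum, ent_eq_sum]
  linarith

theorem ent_le_log_card (A : Ω → α) : ent μ A ≤ log (Fintype.card α) := by
  obtain ⟨ω₀⟩ : Nonempty Ω := nonempty_of_isProbabilityMeasure μ
  have : Nonempty α := ⟨A ω₀⟩
  have hN : (0 : ℝ) < Fintype.card α := by exact_mod_cast Fintype.card_pos
  set N : ℝ := (Fintype.card α : ℝ) with hNdef
  have h : ∀ a, negMulLog (μ.real (A ⁻¹' {a})) ≤
      μ.real (A ⁻¹' {a}) * log N + N⁻¹ - μ.real (A ⁻¹' {a}) := by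
    intro a
    rcases (measureReal_nonneg (μ := μ) (s := A ⁻¹' {a})).eq_or_lt with h | h
    · rw [← h]
      simp [hN.le]
    · set p := μ.real (A ⁻¹' {a})
      have := log_le_sub_one_of_pos (x := (p * N)⁻¹) (by positivity)
      rw [log_inv, log_mul h.ne' hN.ne'] at this
      have h2 := mul_le_mul_of_nonneg_left this h.le
      have h3 : p * ((p * N)⁻¹ - 1) = N⁻¹ - p := by field_simp
      rw [h3] at h2
      rw [negMulLog]
      linarith
  calc ent μ A ≤ ∑ a, (μ.real (A ⁻¹' {a}) * log N + N⁻¹ - μ.real (A ⁻¹' {a})) :=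
        Finset.sum_le_sum fun a _ => h a
    _ = log N := by
        rw [Finset.sum_sub_distrib, Finset.sum_add_distrib, ← Finset.sum_mul,
          sum_real_preimage_singleton_eq_one]
        simp [← hNdef, hN.ne']

theorem ent_pair_of_indep {A : Ω → α} {B : Ω → β}
    (h : ∀ a b, μ.real (A ⁻¹' {a} ∩ B ⁻¹' {b}) = μ.real (A ⁻¹' {a}) * μ.real (B ⁻¹' {b})) :
    ent μ (fun ω => (A ω, B ω)) = ent μ A + ent μ B := by
  rw [ent_eq_sum, ent_eq_sum, ent_eq_sum, ← neg_add, ← Finset.sum_add_distrib]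
  congr 1
  refine Finset.sum_congr rfl fun ω _ => ?_
  have hset : (fun ω => (A ω, B ω)) ⁻¹' {(A ω, B ω)} = A ⁻¹' {A ω} ∩ B ⁻¹' {B ω} := by
    ext; simp
  rw [hset, h]
  rcases (measureReal_nonneg (μ := μ) (s := {ω})).eq_or_lt with h0 | h0
  · simp [← h0]
  · rw [log_mul (real_preimage_pos μ h0).ne' (real_preimage_pos μ h0).ne']
    ring

end Entropy

/-! ### Uniform mixtures -/

section Mixture

variable {Ω Ω₂ : Type*} [Fintype Ω] [MeasurableSpace Ω] [MeasurableSingletonClass Ω]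
  [Fintype Ω₂] [MeasurableSpace Ω₂] [MeasurableSingletonClass Ω₂]

/-- The law of `T I ω`, where `ω` has law `μ` and `I` is independent of `ω` and uniform. -/
def mix (μ : Measure Ω) {n : ℕ} (T : Fin n → Ω → Ω₂) : Measure Ω₂ :=
  (n : ℝ≥0∞)⁻¹ • ∑ i, μ.map (T i)

variable (μ : Measure Ω) {n : ℕ} (T : Fin n → Ω → Ω₂)

theorem mix_apply (s : Set Ω₂) : mix μ T s = (n : ℝ≥0∞)⁻¹ * ∑ i, μ (T i ⁻¹' s) := by
  rw [mix, Measure.smul_apply, Measure.finsetSum_apply, smul_eq_mul]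
  congr 1
  exact Finset.sum_congr rfl fun i _ =>
    Measure.map_apply (measurable_of_finite _) MeasurableSet.of_discrete

theorem mix_apply_of_forall_eq (hn : 0 < n) {s : Set Ω₂} {c : ℝ≥0∞}
    (h : ∀ i, μ (T i ⁻¹' s) = c) : mix μ T s = c := by
  rw [mix_apply, Finset.sum_congr rfl fun i _ => h i, Finset.sum_const, Finset.card_univ,
    Fintype.card_fin, nsmul_eq_mul, ← mul_assoc,
    ENNReal.inv_mul_cancel (by exact_mod_cast hn.ne') (ENNReal.natCast_ne_top n), one_mul]

variable [IsProbabilityMeasure μ]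

theorem mix_real_apply (s : Set Ω₂) :
    (mix μ T).real s = (n : ℝ)⁻¹ * ∑ i, μ.real (T i ⁻¹' s) := by
  rw [measureReal_def, mix_apply, ENNReal.toReal_mul,
    ENNReal.toReal_sum fun _ _ => measure_ne_top _ _]
  simp [measureReal_def]

theorem isProbabilityMeasure_mix (hn : 0 < n) : IsProbabilityMeasure (mix μ T) :=
  ⟨mix_apply_of_forall_eq μ T hn fun i => by simp⟩

theorem ent_mix {α : Type*} [Fintype α] (hn : 0 < n) (A : Fin n → Ω → α) (V : Ω₂ → Fin n × α)
    (hV : ∀ i ω, V (T i ω) = (i, A i ω)) :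
    ent (mix μ T) V = log n + (n : ℝ)⁻¹ * ∑ i, ent μ (A i) := by
  have hV' : ∀ i a, (mix μ T).real (V ⁻¹' {(i, a)}) = (n : ℝ)⁻¹ * μ.real (A i ⁻¹' {a}) := by
    intro i a
    rw [mix_real_apply, Finset.sum_eq_single i]
    · congr 2
      ext ω
      simp [hV]
    · intro j _ hj
      have : T j ⁻¹' (V ⁻¹' {(i, a)}) = ∅ := by
        ext ω
        simp [hV, hj]
      simp [this]
    · simp
  have hn' : (n : ℝ) ≠ 0 := by positivity
  simp only [ent, Fintype.sum_prod_type, ← measureReal_def, hV', negMulLog_mul,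
    Finset.sum_add_distrib, ← Finset.sum_mul, ← Finset.mul_sum,
    sum_real_preimage_singleton_eq_one]
  simp [negMulLog]
  field_simp

/-- If the mixing index is part of `U` and `V` has the same entropy under every component, then
`I(V; U)` is the average of the mutual informations of the components. -/
theorem miFin_mix {α β γ : Type*} [Fintype α] [Fintype β] [Fintype γ] (hn : 0 < n)
    (v : Fin n → Ω → β) (A : Fin n → Ω → α) (V : Ω₂ → β) (U : Ω₂ → γ) (e : Fin n × α ≃ γ)
    (hV : ∀ i ω, V (T i ω) = v i ω) (hU : ∀ i ω, U (T i ω) = e (i, A i ω))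
    (hent : ∀ i, ent μ (v i) = ent (mix μ T) V) :
    miFin (mix μ T) V U = (∑ i, miFin μ (v i) (A i)) / n := by
  have := isProbabilityMeasure_mix μ T hn
  have hn' : (n : ℝ) ≠ 0 := by positivity
  have h1 : ent (mix μ T) U = log n + (n : ℝ)⁻¹ * ∑ i, ent μ (A i) := by
    rw [← ent_mix μ T hn A (fun p => e.symm (U p)) fun i ω => by simp [hU]]
    exact ent_congr _ fun p p' => by simp
  have h2 : ent (mix μ T) (fun p => (V p, U p)) =
      log n + (n : ℝ)⁻¹ * ∑ i, ent μ fun ω => (v i ω, A i ω) := by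
    rw [← ent_mix μ T hn (fun i ω => (v i ω, A i ω))
      (fun p => ((e.symm (U p)).1, V p, (e.symm (U p)).2)) fun i ω => by simp [hU, hV]]
    refine ent_congr _ fun p p' => ?_
    rw [Prod.mk.injEq, ← e.symm.apply_eq_iff_eq, Prod.ext_iff (x := e.symm (U p))]
    simp only [Prod.mk.injEq]
    tauto
  simp only [miFin, h1, h2, hent, Finset.sum_sub_distrib, Finset.sum_add_distrib,
    Finset.sum_const, Finset.card_univ, Fintype.card_fin, nsmul_eq_mul]
  field_simp
  ring

end Mixture

/-! ### Prefixes and suffixes of finite sequences -/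

section Prefix

variable {Z α : Type*} {n : ℕ}

/-- The first `t` letters of the sequence `g (ω 0), g (ω 1), …`. -/
def pre (g : Z → α) (t : ℕ) (ω : Fin n → Z) : Fin n → Option α :=
  fun j => if (j : ℕ) < t then some (g (ω j)) else none

/-- The letters of the sequence `ω` from index `t` on. -/
def suf (t : ℕ) (ω : Fin n → Z) : Fin n → Option Z :=
  fun j => if (j : ℕ) < t then none else some (ω j)

theorem pre_eq_iff (g : Z → α) (t : ℕ) (ω ω' : Fin n → Z) :
    pre g t ω = pre g t ω' ↔ ∀ j : Fin n, (j : ℕ) < t → g (ω j) = g (ω' j) := by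
  simp only [funext_iff, pre]
  refine forall_congr' fun j => ?_
  split_ifs with h <;> simp [h]

theorem suf_eq_iff (t : ℕ) (ω ω' : Fin n → Z) :
    suf t ω = suf t ω' ↔ ∀ j : Fin n, t ≤ (j : ℕ) → ω j = ω' j := by
  simp only [funext_iff, suf]
  refine forall_congr' fun j => ?_
  split_ifs with h
  · simp [h]
  · simp [not_lt.1 h]

theorem pre_succ_eq_iff (g : Z → α) (i : Fin n) (ω ω' : Fin n → Z) :
    pre g (i + 1) ω = pre g (i + 1) ω' ↔
      pre g i ω = pre g i ω' ∧ g (ω i) = g (ω' i) := by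
  simp only [pre_eq_iff]
  refine ⟨fun h => ⟨fun j hj => h j (by omega), h i (by omega)⟩, fun h j hj => ?_⟩
  rcases Nat.lt_succ_iff_lt_or_eq.1 hj with hj | hj
  · exact h.1 j hj
  · rw [Fin.ext hj]
    exact h.2

theorem pre_length_eq_iff (g : Z → α) (ω ω' : Fin n → Z) :
    pre g n ω = pre g n ω' ↔ (fun i => g (ω i)) = fun i => g (ω' i) := by
  rw [pre_eq_iff, funext_iff]
  exact forall_congr' fun j => by simp

end Prefix

/-! ### Product measures on finite powers -/

section Product

variable {Z : Type*} [Fintype Z] [MeasurableSpace Z] [MeasurableSingletonClass Z]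
  (ν : Measure Z) [IsProbabilityMeasure ν] {n : ℕ}

theorem pi_real_inter_of_disjoint_coords (I : Finset (Fin n)) (s t : Set (Fin n → Z))
    (hs : ∀ ω ω', (∀ i ∈ I, ω i = ω' i) → ω ∈ s → ω' ∈ s)
    (ht : ∀ ω ω', (∀ i ∉ I, ω i = ω' i) → ω ∈ t → ω' ∈ t) :
    (Measure.pi fun _ : Fin n => ν).real (s ∩ t) =
      (Measure.pi fun _ : Fin n => ν).real s * (Measure.pi fun _ : Fin n => ν).real t := by
  have hind := (ProbabilityTheory.iIndepFun_pi (μ := fun _ : Fin n => ν)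
    (X := fun _ z => z) fun _ => aemeasurable_id).indepFun_finset I Iᶜ
    disjoint_compl_right fun i => measurable_pi_apply i
  set φ : (Fin n → Z) → (I → Z) := fun ω i => ω i
  set ψ : (Fin n → Z) → ((Iᶜ : Finset (Fin n)) → Z) := fun ω i => ω i
  have hs' : s = φ ⁻¹' (φ '' s) := by
    refine (Set.subset_preimage_image φ s).antisymm ?_
    rintro ω ⟨ω', h', he⟩
    exact hs ω' ω (fun i hi => congrFun he ⟨i, hi⟩) h'
  have ht' : t = ψ ⁻¹' (ψ '' t) := by
    refine (Set.subset_preimage_image ψ t).antisymm ?_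
    rintro ω ⟨ω', h', he⟩
    exact ht ω' ω (fun i hi => congrFun he ⟨i, by simpa using hi⟩) h'
  have := hind.measure_inter_preimage_eq_mul (φ '' s) (ψ '' t)
    MeasurableSet.of_discrete MeasurableSet.of_discrete
  rw [hs', ht', measureReal_def, this, ENNReal.toReal_mul]
  rfl

theorem pi_real_preimage_eval (i : Fin n) (s : Set Z) :
    (Measure.pi fun _ : Fin n => ν).real ((fun ω => ω i) ⁻¹' s) = ν.real s :=
  congrArg ENNReal.toReal ((measurePreserving_eval (fun _ : Fin n => ν) i).measure_preimage
    MeasurableSet.of_discrete.nullMeasurableSet)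

theorem ent_pi_pair {α β : Type*} [Fintype α] [Fintype β] (I : Finset (Fin n))
    {A : (Fin n → Z) → α} {B : (Fin n → Z) → β}
    (hA : ∀ ω ω', (∀ i ∈ I, ω i = ω' i) → A ω = A ω')
    (hB : ∀ ω ω', (∀ i ∉ I, ω i = ω' i) → B ω = B ω') :
    ent (Measure.pi fun _ : Fin n => ν) (fun ω => (A ω, B ω)) =
      ent (Measure.pi fun _ : Fin n => ν) A + ent (Measure.pi fun _ : Fin n => ν) B :=
  ent_pair_of_indep _ fun _ _ => pi_real_inter_of_disjoint_coords ν I _ _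
    (fun ω ω' h hω => (hA ω ω' h).symm.trans hω) (fun ω ω' h hω => (hB ω ω' h).symm.trans hω)

theorem ent_pi_eval {α : Type*} [Fintype α] (g : Z → α) (i : Fin n) :
    ent (Measure.pi fun _ : Fin n => ν) (fun ω => g (ω i)) = ent ν g :=
  Finset.sum_congr rfl fun a _ => congrArg negMulLog (pi_real_preimage_eval ν i (g ⁻¹' {a}))

variable {α : Type*}

theorem ent_pre_zero [Fintype α] (g : Z → α) :
    ent (Measure.pi fun _ : Fin n => ν) (pre g 0) = 0 := by
  have h : ∀ ω : Fin n → Z, pre g 0 ⁻¹' {pre g 0 ω} = Set.univ := fun ω => by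
    ext ω'
    simp [pre_eq_iff]
  rw [ent_eq_sum]
  simp [h]

theorem ent_pre_succ [Fintype α] (g : Z → α) (i : Fin n) :
    ent (Measure.pi fun _ : Fin n => ν) (pre g (i + 1)) =
      ent (Measure.pi fun _ : Fin n => ν) (pre g i) + ent ν g := by
  rw [← ent_pi_eval ν g i, ← ent_pi_pair ν (Finset.univ.filter fun j : Fin n => (j : ℕ) < i)]
  · exact ent_congr _ fun ω ω' => by rw [pre_succ_eq_iff, Prod.mk.injEq]
  · intro ω ω' h
    rw [pre_eq_iff]
    exact fun j hj => by rw [h j (by simpa using hj)]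
  · intro ω ω' h
    rw [h i (by simp)]

theorem ent_pre [Fintype α] (g : Z → α) :
    ent (Measure.pi fun _ : Fin n => ν) (pre g n) = n * ent ν g := by
  have h : ∀ t ≤ n, ent (Measure.pi fun _ : Fin n => ν) (pre g t) = t * ent ν g := by
    intro t
    induction t with
    | zero => simp [ent_pre_zero]
    | succ t ih =>
      intro ht
      have := ent_pre_succ ν g (⟨t, ht⟩ : Fin n)
      simp only at this
      rw [this, ih (by omega)]
      push_cast
      ring
  exact h n le_rfl

/-- For a memoryless pair source, conditioning on the past of one component is at least as
informative about the present of the other component as conditioning on its own past. -/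
theorem ent_cond_pre_le {β M : Type*} [Fintype α] [Fintype β] [Fintype M] (g : Z → α) (h : Z → β)
    (W : (Fin n → Z) → M)
    (hW : ∀ ω ω', (∀ j, h (ω j) = h (ω' j)) → W ω = W ω') (i : Fin n) :
    ent (Measure.pi fun _ : Fin n => ν) (fun ω => (g (ω i), W ω, pre h i ω)) -
        ent (Measure.pi fun _ : Fin n => ν) (fun ω => (W ω, pre h i ω)) ≤
      ent (Measure.pi fun _ : Fin n => ν) (fun ω => (W ω, pre g (i + 1) ω)) -
        ent (Measure.pi fun _ : Fin n => ν) (fun ω => (W ω, pre g i ω)) := by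
  set P := Measure.pi fun _ : Fin n => ν with hP
  have hWW : ∀ ω ω' : Fin n → Z, pre h i ω = pre h i ω' → suf i ω = suf i ω' →
      W ω = W ω' := by
    intro ω ω' h1 h2
    rw [pre_eq_iff] at h1
    rw [suf_eq_iff] at h2
    refine hW _ _ fun j => ?_
    rcases lt_or_ge (j : ℕ) i with hj | hj
    · exact h1 j hj
    · rw [h2 j hj]
  have hgi : ∀ ω ω' : Fin n → Z, suf i ω = suf i ω' → g (ω i) = g (ω' i) := by
    intro ω ω' h2
    rw [suf_eq_iff] at h2
    rw [h2 i le_rfl]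
  have s1 := ent_submodular P (fun ω => g (ω i)) (fun ω => (W ω, pre g i ω)) (pre h i)
  have s2 := ent_submodular P (pre g i) (pre h i) W
  have s3 := ent_submodular P (pre g i) (fun ω => (g (ω i), W ω, pre h i ω)) (suf i)
  have e1 : ent P (fun ω => (pre g i ω, (g (ω i), W ω, pre h i ω), suf i ω)) =
      ent P (fun ω => (pre g i ω, pre h i ω)) + ent P (suf i) := by
    rw [hP, ← ent_pi_pair ν (Finset.univ.filter fun j : Fin n => (j : ℕ) < i)]
    · refine ent_congr _ fun ω ω' => ?_
      have := hWW ω ω'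
      have := hgi ω ω'
      simp only [Prod.mk.injEq]
      tauto
    · intro ω ω' hω
      simp only [Prod.mk.injEq, pre_eq_iff]
      exact ⟨fun j hj => by rw [hω j (by simpa using hj)],
        fun j hj => by rw [hω j (by simpa using hj)]⟩
    · intro ω ω' hω
      rw [suf_eq_iff]
      exact fun j hj => hω j (by simpa using hj)
  have e2 : ent P (fun ω => ((g (ω i), W ω, pre h i ω), suf i ω)) =
      ent P (pre h i) + ent P (suf i) := by
    rw [hP, ← ent_pi_pair ν (Finset.univ.filter fun j : Fin n => (j : ℕ) < i)]
    · refine ent_congr _ fun ω ω' => ?_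
      have := hWW ω ω'
      have := hgi ω ω'
      simp only [Prod.mk.injEq]
      tauto
    · intro ω ω' hω
      rw [pre_eq_iff]
      exact fun j hj => by rw [hω j (by simpa using hj)]
    · intro ω ω' hω
      rw [suf_eq_iff]
      exact fun j hj => hω j (by simpa using hj)
  have e3 : ent P (fun ω => (g (ω i), (W ω, pre g i ω), pre h i ω)) =
      ent P (fun ω => (pre g i ω, g (ω i), W ω, pre h i ω)) :=
    ent_congr _ fun ω ω' => by simp only [Prod.mk.injEq]; tauto
  have e4 : ent P (fun ω => (pre g i ω, pre h i ω, W ω)) =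
      ent P (fun ω => ((W ω, pre g i ω), pre h i ω)) :=
    ent_congr _ fun ω ω' => by simp only [Prod.mk.injEq]; tauto
  have e5 : ent P (fun ω => (pre h i ω, W ω)) = ent P (fun ω => (W ω, pre h i ω)) :=
    ent_congr _ fun ω ω' => by simp only [Prod.mk.injEq]; tauto
  have e6 : ent P (fun ω => (g (ω i), W ω, pre g i ω)) =
      ent P (fun ω => (W ω, pre g (i + 1) ω)) :=
    ent_congr _ fun ω ω' => by simp only [Prod.mk.injEq, pre_succ_eq_iff]; tauto
  linarith

/-- Single-letterization of `I(Xⁿ; W)` for a function `W` of `Xⁿ`. -/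
theorem sum_miFin_pre_eq {β M : Type*} [Fintype β] [Fintype M] (h : Z → β)
    (W : (Fin n → Z) → M) (hW : ∀ ω ω', (∀ j, h (ω j) = h (ω' j)) → W ω = W ω') :
    ∑ i : Fin n, miFin (Measure.pi fun _ : Fin n => ν) (fun ω => h (ω i))
        (fun ω => (W ω, pre h i ω)) =
      ent (Measure.pi fun _ : Fin n => ν) W := by
  set P := Measure.pi fun _ : Fin n => ν with hP
  have e : ∀ i : Fin n, miFin P (fun ω => h (ω i)) (fun ω => (W ω, pre h i ω)) =
      ent ν h - (ent P (fun ω => (W ω, pre h (i + 1) ω)) -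
        ent P (fun ω => (W ω, pre h i ω))) := by
    intro i
    have : ent P (fun ω => (h (ω i), W ω, pre h i ω)) =
        ent P (fun ω => (W ω, pre h (i + 1) ω)) :=
      ent_congr _ fun ω ω' => by simp only [Prod.mk.injEq, pre_succ_eq_iff]; tauto
    rw [miFin, this, hP, ent_pi_eval]
    ring
  rw [Finset.sum_congr rfl fun i _ => e i, Finset.sum_sub_distrib,
    Fin.sum_univ_eq_sum_range (fun t => ent P (fun ω => (W ω, pre h (t + 1) ω)) -
      ent P (fun ω => (W ω, pre h t ω))),
    Finset.sum_range_sub (fun t => ent P (fun ω => (W ω, pre h t ω)))]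
  have e0 : ent P (fun ω => (W ω, pre h 0 ω)) = ent P W :=
    ent_congr _ fun ω ω' => by simp [pre_eq_iff]
  have en : ent P (fun ω => (W ω, pre h n ω)) = ent P (pre h n) :=
    ent_congr _ fun ω ω' => by
      simp only [Prod.mk.injEq, pre_eq_iff, and_iff_right_iff_imp]
      exact fun H => hW _ _ fun j => H j j.2
  rw [e0, en, hP, ent_pre]
  simp

theorem miFin_le_sum_miFin_pre {β M : Type*} [Fintype α] [Fintype β] [Fintype M] (g : Z → α)
    (h : Z → β) (W : (Fin n → Z) → M)
    (hW : ∀ ω ω', (∀ j, h (ω j) = h (ω' j)) → W ω = W ω') :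
    miFin (Measure.pi fun _ : Fin n => ν) (fun ω i => g (ω i)) W ≤
      ∑ i : Fin n, miFin (Measure.pi fun _ : Fin n => ν) (fun ω => g (ω i))
        (fun ω => (W ω, pre h i ω)) := by
  set P := Measure.pi fun _ : Fin n => ν with hP
  have e : ∀ i : Fin n, ent ν g - (ent P (fun ω => (W ω, pre g (i + 1) ω)) -
        ent P (fun ω => (W ω, pre g i ω))) ≤
      miFin P (fun ω => g (ω i)) (fun ω => (W ω, pre h i ω)) := by
    intro i
    have := ent_cond_pre_le ν g h W hW i
    rw [miFin, hP, ent_pi_eval]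
    linarith
  refine le_trans (le_of_eq ?_) (Finset.sum_le_sum fun i _ => e i)
  rw [Finset.sum_sub_distrib,
    Fin.sum_univ_eq_sum_range (fun t => ent P (fun ω => (W ω, pre g (t + 1) ω)) -
      ent P (fun ω => (W ω, pre g t ω))),
    Finset.sum_range_sub (fun t => ent P (fun ω => (W ω, pre g t ω)))]
  have e0 : ent P (fun ω => (W ω, pre g 0 ω)) = ent P W :=
    ent_congr _ fun ω ω' => by simp [pre_eq_iff]
  have en : ent P (fun ω => (W ω, pre g n ω)) = ent P (fun ω => ((fun i => g (ω i)), W ω)) :=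
    ent_congr _ fun ω ω' => by
      rw [Prod.mk.injEq, Prod.mk.injEq, pre_length_eq_iff, and_comm]
  have en' : ent P (fun ω i => g (ω i)) = ent P (pre g n) :=
    ent_congr _ fun ω ω' => (pre_length_eq_iff g ω ω').symm
  rw [miFin, e0, en, en', hP, ent_pre]
  simp
  ring

end Product

/-! ### Markov chains on finite probability spaces -/

section Markov

variable {Ω β : Type*} [Fintype Ω] [MeasurableSpace Ω] [MeasurableSingletonClass Ω]
  [Fintype β] [MeasurableSpace β] [MeasurableSingletonClass β]
  (μ : Measure Ω) [IsProbabilityMeasure μ]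

theorem condExp_ind_comap (s : Set Ω) (B : Ω → β) :
    μ[ind s | MeasurableSpace.comap B inferInstance] =ᵐ[μ]
      fun ω => μ.real (s ∩ B ⁻¹' {B ω}) / μ.real (B ⁻¹' {B ω}) := by
  classical
  have hm : MeasurableSpace.comap B inferInstance ≤ (inferInstance : MeasurableSpace Ω) :=
    (measurable_of_finite B).comap_le
  refine (ae_eq_condExp_of_forall_setIntegral_eq hm Integrable.of_finite
    (fun _ _ _ => Integrable.of_finite.integrableOn) ?_ ?_).symm
  · rintro _ ⟨S, -, rfl⟩ -
    rw [ind, setIntegral_indicator MeasurableSet.of_discrete, setIntegral_const,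
      ← integral_indicator MeasurableSet.of_discrete, integral_fintype Integrable.of_finite]
    set F : β → ℝ := S.indicator fun b => μ.real (s ∩ B ⁻¹' {b}) / μ.real (B ⁻¹' {b})
    have h1 : ∀ ω, (B ⁻¹' S).indicator
        (fun ω => μ.real (s ∩ B ⁻¹' {B ω}) / μ.real (B ⁻¹' {B ω})) ω = F (B ω) := by
      intro ω
      by_cases h : B ω ∈ S <;> simp [F, h]
    simp only [h1, smul_eq_mul, mul_one]
    rw [sum_real_mul_comp μ B F]
    have h2 : ∀ b, μ.real (B ⁻¹' {b}) * F b = S.indicator (fun b => μ.real (s ∩ B ⁻¹' {b})) b := by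
      intro b
      by_cases h : b ∈ S
      · simp only [F, Set.indicator_of_mem h]
        refine mul_div_cancel_of_imp' fun h0 => ?_
        exact measureReal_mono_null Set.inter_subset_right h0
      · simp [F, h]
    have h3 := sum_measureReal_preimage_singleton (μ := μ.restrict s) (f := B) S.toFinset
      fun _ _ => MeasurableSet.of_discrete
    simp only [h2]
    rw [Set.coe_toFinset, measureReal_restrict_apply MeasurableSet.of_discrete] at h3
    rw [← h3, Finset.sum_indicator_eq_sum_filter]
    refine Finset.sum_congr (by ext; simp) fun b _ => ?_
    rw [measureReal_restrict_apply MeasurableSet.of_discrete, Set.inter_comm]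
  · refine Measurable.aestronglyMeasurable ?_
    exact (measurable_of_finite fun b => μ.real (s ∩ B ⁻¹' {b}) / μ.real (B ⁻¹' {b})).comp
      (comap_measurable B)

/-- If the joint law factors as `P(A ∈ E, B = b, C ∈ F) = a(E, b) c(F, b)`, then `A`, `B`, `C` form
a Markov chain. -/
theorem markov_of_factorization {α γ : Type*} [MeasurableSpace α] [MeasurableSpace γ]
    (A : Ω → α) (B : Ω → β) (C : Ω → γ) (a : Set α → β → ℝ) (c : Set γ → β → ℝ)
    (h : ∀ E F b, μ.real (A ⁻¹' E ∩ C ⁻¹' F ∩ B ⁻¹' {b}) = a E b * c F b) :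
    Markov μ A B C := by
  intro E F _ _
  filter_upwards [condExp_ind_comap μ (A ⁻¹' E ∩ C ⁻¹' F) B, condExp_ind_comap μ (A ⁻¹' E) B,
    condExp_ind_comap μ (C ⁻¹' F) B] with ω h1 h2 h3
  rw [h1, h2, h3]
  have hE := h E Set.univ (B ω)
  have hF := h Set.univ F (B ω)
  have hu := h Set.univ Set.univ (B ω)
  simp only [Set.preimage_univ, Set.inter_univ, Set.univ_inter] at hE hF hu
  rw [h, hE, hF, hu]
  rcases eq_or_ne (a Set.univ (B ω) * c Set.univ (B ω)) 0 with h0 | h0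
  · simp [h0]
  · have := left_ne_zero_of_mul h0
    have := right_ne_zero_of_mul h0
    field_simp

end Markov

/-- Lemma 8 of the paper, discrete converse: for finite `𝒴`, `𝒳` and any
`f : 𝒳ⁿ → M`, there is an extension `μ'` of the law `μYX` by a finite-alphabet `U` such that
`Y ⊸ X ⊸ U`, `I(X;U) ≤ (1/n) log |M|` and `I(Y;U) ≥ (1/n) I(Yⁿ; f(Xⁿ))`. -/
theorem discrete_outer_bound
    {𝒴 𝒳 : Type*}
    [Fintype 𝒴] [MeasurableSpace 𝒴] [MeasurableSingletonClass 𝒴]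
    [Fintype 𝒳] [MeasurableSpace 𝒳] [MeasurableSingletonClass 𝒳]
    (μYX : Measure (𝒴 × 𝒳)) [IsProbabilityMeasure μYX]
    (n : ℕ) (hn : 0 < n) {M : Type*} [Fintype M] (f : (Fin n → 𝒳) → M) :
    ∃ (k : ℕ) (μ' : Measure (𝒴 × 𝒳 × Fin (k + 1))),
      IsProbabilityMeasure μ' ∧
      Measure.map (fun p => (p.1, p.2.1)) μ' = μYX ∧
      Markov μ' (fun p => p.1) (fun p => p.2.1) (fun p => p.2.2) ∧
      miFin μ' (fun p => p.2.1) (fun p => p.2.2) ≤ Real.log (Fintype.card M) / n ∧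
      miFin (Measure.pi fun _ : Fin n => μYX)
          (fun ω i => (ω i).1) (fun ω => f fun i => (ω i).2) / n ≤
        miFin μ' (fun p => p.1) (fun p => p.2.2) := by
  classical
  set P : Measure (Fin n → 𝒴 × 𝒳) := Measure.pi fun _ : Fin n => μYX with hP
  set W : (Fin n → 𝒴 × 𝒳) → M := fun ω => f fun i => (ω i).2
  have hW : ∀ ω ω', (∀ j, (ω j).2 = (ω' j).2) → W ω = W ω' := fun ω ω' h =>
    congrArg f (funext h)
  obtain ⟨ω₀⟩ : Nonempty (Fin n → 𝒴 × 𝒳) := nonempty_of_isProbabilityMeasure P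
  have : Nonempty (Fin n × M × (Fin n → Option 𝒳)) := ⟨⟨0, hn⟩, W ω₀, fun _ => none⟩
  obtain ⟨k, hk⟩ := Nat.exists_eq_succ_of_ne_zero
    (Fintype.card_ne_zero (α := Fin n × M × (Fin n → Option 𝒳)))
  let e : Fin n × M × (Fin n → Option 𝒳) ≃ Fin (k + 1) := Fintype.equivFinOfCardEq hk
  let A : Fin n → (Fin n → 𝒴 × 𝒳) → M × (Fin n → Option 𝒳) :=
    fun i ω => (W ω, pre Prod.snd i ω)
  let T : Fin n → (Fin n → 𝒴 × 𝒳) → 𝒴 × 𝒳 × Fin (k + 1) :=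
    fun i ω => ((ω i).1, (ω i).2, e (i, A i ω))
  have hA : ∀ i ω ω', (∀ j, (ω j).2 = (ω' j).2) → A i ω = A i ω' := fun i ω ω' h =>
    Prod.ext (hW ω ω' h) ((pre_eq_iff _ _ _ _).2 fun j _ => h j)
  have hprob : IsProbabilityMeasure (mix P T) := isProbabilityMeasure_mix P T hn
  have hmap : Measure.map (fun p => (p.1, p.2.1)) (mix P T) = μYX := by
    ext s -
    rw [Measure.map_apply (measurable_of_finite _) MeasurableSet.of_discrete]
    exact mix_apply_of_forall_eq P T hn fun i =>
      (measurePreserving_eval (fun _ : Fin n => μYX) i).measure_preimage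
        MeasurableSet.of_discrete.nullMeasurableSet
  refine ⟨k, mix P T, hprob, hmap, ?_, ?_, ?_⟩
  · refine markov_of_factorization (mix P T) _ _ _ (fun E x => μYX.real (E ×ˢ {x}))
      (fun F x => (n : ℝ)⁻¹ * ∑ i, P.real
        {ω | e (i, A i (Function.update ω i ((ω i).1, x))) ∈ F}) fun E F x => ?_
    rw [mix_real_apply, mul_left_comm, Finset.mul_sum (a := μYX.real (E ×ˢ {x}))]
    congr 1
    refine Finset.sum_congr rfl fun i _ => ?_
    rw [← pi_real_preimage_eval μYX i, hP, ← pi_real_inter_of_disjoint_coords μYX {i}]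
    · congr 1
      ext ω
      by_cases hx : (ω i).2 = x
      · subst hx
        simp [T]
      · simp [T, hx]
    · intro ω ω' h hω
      rw [Set.mem_preimage] at hω ⊢
      rwa [← h i (by simp)]
    · intro ω ω' h hω
      rw [Set.mem_ofPred_eq] at hω ⊢
      rwa [hA i (Function.update ω' i ((ω' i).1, x)) (Function.update ω i ((ω i).1, x))]
      intro j
      rcases eq_or_ne j i with rfl | hj
      · simp
      · simp [hj, h j (by simpa using hj)]
  · rw [miFin_mix P T hn (fun i ω => (ω i).2) A (fun p => p.2.1) (fun p => p.2.2) e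
      (fun _ _ => rfl) (fun _ _ => rfl) fun i => ?_]
    · rw [sum_miFin_pre_eq μYX Prod.snd W hW]
      gcongr
      exact ent_le_log_card P W
    · rw [hP, ent_pi_eval μYX Prod.snd, ← hP]
      conv_lhs => rw [← hmap]
      rw [ent_map]
  · rw [miFin_mix P T hn (fun i ω => (ω i).1) A (fun p => p.1) (fun p => p.2.2) e
      (fun _ _ => rfl) (fun _ _ => rfl) fun i => ?_]
    · gcongr
      exact miFin_le_sum_miFin_pre μYX Prod.fst Prod.snd W hW
    · rw [hP, ent_pi_eval μYX Prod.fst, ← hP]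
      conv_lhs => rw [← hmap]
      rw [ent_map]

end IB
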